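/- arXiv:2203.10864 — 2 statements merged into one kernel-verified Lean document; each statement's English description precedes it below -/
import Mathlib

section
/- Let p be a merging function for (X,Ω) with merged weighted data set (X̃,Ω̃), let C ∈ C_K(k,X,Ω), let S be a k-tuple of sites, and set D = Σ_{i=1}^k Σ_{j=1}^n ξ_{ij}ω_j‖x̃_{p(j)} − x_j‖_{A_i}². Then cost_{A,K}(X̃,p(C),S) = Σ_{i=1}^k Σ_{j=1}^n ξ_{ij}ω_j‖x̃_{p(j)} − s_i‖_{A_i}², and cost_{A,K}(X,C,S) − 2·√(D·cost_{A,K}(X,C,S)) ≤ cost_{A,K}(X̃,p(C),S) ≤ cost_{A,K}(X,C,S) + 2·√(D·cost_{A,K}(X,C,S)) + D. -/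
open Finset Matrix

noncomputable section

/-- Squared anisotropic (ellipsoidal) norm `‖v‖_A² = vᵀ A v`. -/
def anormSq {d : ℕ} (A : Matrix (Fin d) (Fin d) ℝ) (v : Fin d → ℝ) : ℝ :=
  v ⬝ᵥ A.mulVec v

/-- `ξ` is a (fractional) `k`-clustering of `n` points. -/
def IsClustering {k n : ℕ} (ξ : Fin k → Fin n → ℝ) : Prop :=
  (∀ i j, 0 ≤ ξ i j) ∧ ∀ j, ∑ i, ξ i j = 1

/-- The weight `ω(C_i)` of the `i`-th cluster. -/
def clusterWeight {k n : ℕ} (ω : Fin n → ℝ) (ξ : Fin k → Fin n → ℝ) (i : Fin k) : ℝ :=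
  ∑ j, ξ i j * ω j

/-- `ξ` is a weight-constrained `k`-clustering (an element of `C_K(k,X,Ω)`). -/
def IsWCC {k n : ℕ} (κlo κhi : Fin k → ℝ) (ω : Fin n → ℝ) (ξ : Fin k → Fin n → ℝ) : Prop :=
  IsClustering ξ ∧ ∀ i, κlo i ≤ clusterWeight ω ξ i ∧ clusterWeight ω ξ i ≤ κhi i

/-- `cost_{A,K}(X,C,S)`. -/
def cost {d k n : ℕ} (A : Fin k → Matrix (Fin d) (Fin d) ℝ)
    (x : Fin n → Fin d → ℝ) (ω : Fin n → ℝ) (ξ : Fin k → Fin n → ℝ)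
    (s : Fin k → Fin d → ℝ) : ℝ :=
  ∑ i, ∑ j, ξ i j * ω j * anormSq (A i) (x j - s i)

/-- `cost_{A,K}(X,S)`: optimal constrained assignment cost for fixed sites `s`. -/
def assignCost {d k n : ℕ} (κlo κhi : Fin k → ℝ) (A : Fin k → Matrix (Fin d) (Fin d) ℝ)
    (x : Fin n → Fin d → ℝ) (ω : Fin n → ℝ) (s : Fin k → Fin d → ℝ) : ℝ :=
  sInf {c : ℝ | ∃ ξ, IsWCC κlo κhi ω ξ ∧ c = cost A x ω ξ s}

/-- `cost_{A,K}(X,C)`: infimum over site tuples. -/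
def clusterCost {d k n : ℕ} (A : Fin k → Matrix (Fin d) (Fin d) ℝ)
    (x : Fin n → Fin d → ℝ) (ω : Fin n → ℝ) (ξ : Fin k → Fin n → ℝ) : ℝ :=
  sInf {c : ℝ | ∃ s : Fin k → Fin d → ℝ, c = cost A x ω ξ s}

/-- `OPT_{A,K}(X)`. -/
def OPTc {d k n : ℕ} (κlo κhi : Fin k → ℝ) (A : Fin k → Matrix (Fin d) (Fin d) ℝ)
    (x : Fin n → Fin d → ℝ) (ω : Fin n → ℝ) : ℝ :=
  sInf {c : ℝ | ∃ ξ, IsWCC κlo κhi ω ξ ∧ c = clusterCost A x ω ξ}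

/-- Unconstrained optimum `OPT_A(X)` (over all clusterings and all site tuples). -/
def OPTu {d k n : ℕ} (A : Fin k → Matrix (Fin d) (Fin d) ℝ)
    (x : Fin n → Fin d → ℝ) (ω : Fin n → ℝ) : ℝ :=
  sInf {c : ℝ | ∃ ξ, ∃ s : Fin k → Fin d → ℝ, IsClustering ξ ∧ c = cost A x ω ξ s}

/-- `(X',Ω')` is an `(ε,δ)`-coreset for `(k,X,Ω,A,K)`, witnessed by the extension `f`
and the offsets `Δp`, `Δm`. -/
def IsCoresetWith {d k n m : ℕ} (ε δ : ℝ) (κlo κhi : Fin k → ℝ)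
    (A : Fin k → Matrix (Fin d) (Fin d) ℝ)
    (x : Fin n → Fin d → ℝ) (ω : Fin n → ℝ)
    (x' : Fin m → Fin d → ℝ) (ω' : Fin m → ℝ)
    (f : (Fin k → Fin m → ℝ) → (Fin k → Fin n → ℝ)) (Δp Δm : ℝ) : Prop :=
  0 ≤ Δp ∧ Δp ≤ δ * Δm ∧
  (∀ ξ', IsWCC κlo κhi ω' ξ' → IsWCC κlo κhi ω (f ξ')) ∧
  ∀ (s : Fin k → Fin d → ℝ) (ξ' : Fin k → Fin m → ℝ), IsWCC κlo κhi ω' ξ' →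
    (1 - ε) * cost A x ω (f ξ') s ≤ cost A x' ω' ξ' s + Δp ∧
    assignCost κlo κhi A x' ω' s + Δm ≤ (1 + ε) * assignCost κlo κhi A x ω s


/-- The bilinear form `(u, v) ↦ uᵀ A v`, summed over clusters and points with the
coefficients `c`. -/
def crossTerm {d k n : ℕ} (A : Fin k → Matrix (Fin d) (Fin d) ℝ) (c : Fin k → Fin n → ℝ)
    (u v : Fin k → Fin n → Fin d → ℝ) : ℝ :=
  ∑ i, ∑ j, c i j * (u i j ⬝ᵥ (A i).mulVec (v i j))

theorem anormSq_nonneg {d : ℕ} {A : Matrix (Fin d) (Fin d) ℝ} (hA : A.PosDef)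
    (v : Fin d → ℝ) : 0 ≤ anormSq A v := by
  simpa [anormSq] using hA.posSemidef.dotProduct_mulVec_nonneg v

theorem anormSq_add_smul {d : ℕ} {A : Matrix (Fin d) (Fin d) ℝ} (hA : A.PosDef) (t : ℝ)
    (u v : Fin d → ℝ) :
    anormSq A (u + t • v) = anormSq A u + 2 * t * (u ⬝ᵥ A.mulVec v) + t ^ 2 * anormSq A v := by
  have hT : Aᵀ = A := by simpa using hA.isHermitian.eq
  have hsymm : v ⬝ᵥ A.mulVec u = u ⬝ᵥ A.mulVec v := by
    rw [dotProduct_mulVec, ← mulVec_transpose, hT, dotProduct_comm]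
  simp only [anormSq, mulVec_add, mulVec_smul, add_dotProduct, dotProduct_add, smul_dotProduct,
    dotProduct_smul, smul_eq_mul, hsymm]
  ring

theorem sum_anormSq_add_smul {d k n : ℕ} {A : Fin k → Matrix (Fin d) (Fin d) ℝ}
    (hA : ∀ i, (A i).PosDef) (c : Fin k → Fin n → ℝ) (t : ℝ)
    (u v : Fin k → Fin n → Fin d → ℝ) :
    ∑ i, ∑ j, c i j * anormSq (A i) (u i j + t • v i j) =
      ∑ i, ∑ j, c i j * anormSq (A i) (u i j) + 2 * t * crossTerm A c u v +
        t ^ 2 * ∑ i, ∑ j, c i j * anormSq (A i) (v i j) := by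
  simp only [crossTerm, anormSq_add_smul (hA _), mul_sum, ← sum_add_distrib]
  exact sum_congr rfl fun i _ => sum_congr rfl fun j _ => by ring

/-- Cauchy–Schwarz inequality for the weighted sum of anisotropic inner products. -/
theorem abs_crossTerm_le {d k n : ℕ} {A : Fin k → Matrix (Fin d) (Fin d) ℝ}
    (hA : ∀ i, (A i).PosDef) {c : Fin k → Fin n → ℝ} (hc : ∀ i j, 0 ≤ c i j)
    (u v : Fin k → Fin n → Fin d → ℝ) :
    |crossTerm A c u v| ≤ Real.sqrt ((∑ i, ∑ j, c i j * anormSq (A i) (u i j)) *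
      ∑ i, ∑ j, c i j * anormSq (A i) (v i j)) := by
  refine Real.abs_le_sqrt ?_
  have h := discrim_le_zero (a := ∑ i, ∑ j, c i j * anormSq (A i) (v i j))
    (b := 2 * crossTerm A c u v) (c := ∑ i, ∑ j, c i j * anormSq (A i) (u i j)) fun t => by
      have hnonneg : 0 ≤ ∑ i, ∑ j, c i j * anormSq (A i) (u i j + t • v i j) :=
        sum_nonneg fun i _ => sum_nonneg fun j _ =>
          mul_nonneg (hc i j) (anormSq_nonneg (hA i) _)
      rw [sum_anormSq_add_smul hA] at hnonneg
      linarith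
  rw [discrim] at h
  linarith

theorem cost_merged {d k n m : ℕ} (A : Fin k → Matrix (Fin d) (Fin d) ℝ)
    {ω : Fin n → ℝ} (hω : ∀ j, 0 < ω j) {p : Fin n → Fin m} (hp : Function.Surjective p)
    (x' : Fin m → Fin d → ℝ) {ω' : Fin m → ℝ}
    (hω' : ω' = fun j' => ∑ j ∈ univ.filter (fun j => p j = j'), ω j)
    (ξ : Fin k → Fin n → ℝ) {ξ' : Fin k → Fin m → ℝ}
    (hξ' : ξ' = fun i j' => (ω' j')⁻¹ * ∑ j ∈ univ.filter (fun j => p j = j'), ξ i j * ω j)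
    (s : Fin k → Fin d → ℝ) :
    cost A x' ω' ξ' s = ∑ i, ∑ j, ξ i j * ω j * anormSq (A i) (x' (p j) - s i) := by
  have hpos : ∀ j', ω' j' ≠ 0 := fun j' => by
    obtain ⟨j, hj⟩ := hp j'
    rw [hω']
    exact (sum_pos (fun j _ => hω j) ⟨j, by simp [hj]⟩).ne'
  refine sum_congr rfl fun i _ => ?_
  rw [← sum_fiberwise (s := univ) (g := p)]
  refine sum_congr rfl fun j' _ => ?_
  have hweight : ξ' i j' * ω' j' = ∑ j ∈ univ.filter (fun j => p j = j'), ξ i j * ω j := by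
    rw [hξ']
    field_simp [hpos j']
  rw [hweight, sum_mul]
  refine sum_congr rfl fun j hj => ?_
  rw [(mem_filter.mp hj).2]

theorem statement8 {d k n m : ℕ}
    (A : Fin k → Matrix (Fin d) (Fin d) ℝ) (hA : ∀ i, (A i).PosDef)
    (κlo κhi : Fin k → ℝ)
    (x : Fin n → Fin d → ℝ) (ω : Fin n → ℝ) (hω : ∀ j, 0 < ω j)
    (p : Fin n → Fin m) (hp : Function.Surjective p)
    (x' : Fin m → Fin d → ℝ)
    (ω' : Fin m → ℝ) (hω' : ω' = fun j' => ∑ j ∈ univ.filter (fun j => p j = j'), ω j)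
    (ξ : Fin k → Fin n → ℝ) (hξ : IsWCC κlo κhi ω ξ)
    (ξ' : Fin k → Fin m → ℝ)
    (hξ' : ξ' = fun i j' => (ω' j')⁻¹ * ∑ j ∈ univ.filter (fun j => p j = j'), ξ i j * ω j)
    (s : Fin k → Fin d → ℝ)
    (D : ℝ) (hD : D = ∑ i, ∑ j, ξ i j * ω j * anormSq (A i) (x' (p j) - x j)) :
    cost A x' ω' ξ' s = ∑ i, ∑ j, ξ i j * ω j * anormSq (A i) (x' (p j) - s i) ∧
    cost A x ω ξ s - 2 * Real.sqrt (D * cost A x ω ξ s) ≤ cost A x' ω' ξ' s ∧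
    cost A x' ω' ξ' s ≤ cost A x ω ξ s + 2 * Real.sqrt (D * cost A x ω ξ s) + D := by
  have hmerged := cost_merged A hω hp x' hω' ξ hξ' s
  have hc : ∀ i j, 0 ≤ ξ i j * ω j := fun i j => mul_nonneg (hξ.1.1 i j) (hω j).le
  have hexpand := sum_anormSq_add_smul hA (fun i j => ξ i j * ω j) 1
    (fun _ j => x' (p j) - x j) (fun i j => x j - s i)
  have hcross := abs_le.mp <| abs_crossTerm_le hA hc
    (fun _ j => x' (p j) - x j) (fun i j => x j - s i)
  simp only [one_smul, sub_add_sub_cancel, ← hD, ← hmerged] at hexpand hcross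
  have hDnonneg : 0 ≤ D := hD ▸ sum_nonneg fun i _ => sum_nonneg fun j _ =>
    mul_nonneg (hc i j) (anormSq_nonneg (hA i) _)
  change _ = D + _ + 1 ^ 2 * cost A x ω ξ s at hexpand
  change -Real.sqrt (D * cost A x ω ξ s) ≤ _ ∧ _ ≤ Real.sqrt (D * cost A x ω ξ s) at hcross
  exact ⟨hmerged, by linarith [hcross.1], by linarith [hcross.2]⟩

end
end

section
/- Let (k,X,Ω,A,K) be an instance of weight-constrained anisotropic clustering, let p be a merging function for (X,Ω) with merged weighted data set (X̃,Ω̃), and let ε ∈ (0,1/2]. If Σ_{j=1}^n ω_j‖x_j − x̃_{p(j)}‖₂² ≤ (ε²·λ^-(A)/(16·λ^+(A)))·OPT(X), then (X̃,Ω̃) is a linear ε-coreset for (k,X,Ω,A,K), witnessed by the extension f of p and offsets Δ^+ = Δ^- = 0. -/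
open Finset Matrix

noncomputable section

theorem anormSq_one {d : ℕ} (v : Fin d → ℝ) : anormSq 1 v = v ⬝ᵥ v := by
  simp [anormSq]

theorem anormSq_smul_add {d : ℕ} (A : Matrix (Fin d) (Fin d) ℝ) (t : ℝ) (u v : Fin d → ℝ) :
    anormSq A (t • u + v)
      = t ^ 2 * anormSq A u + t * (u ⬝ᵥ A.mulVec v + v ⬝ᵥ A.mulVec u) + anormSq A v := by
  simp only [anormSq, mulVec_add, mulVec_smul, add_dotProduct, dotProduct_add, smul_dotProduct,
    dotProduct_smul, smul_eq_mul]
  ring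

/-- Weighted triangle inequality for a nonnegative quadratic form, in both directions. -/
theorem anormSq_add_bounds {d : ℕ} {A : Matrix (Fin d) (Fin d) ℝ} (hA : ∀ w, 0 ≤ anormSq A w)
    {t : ℝ} (ht : 0 < t) (u v : Fin d → ℝ) :
    (1 - t) * anormSq A u + (1 - 1 / t) * anormSq A v ≤ anormSq A (u + v) ∧
      anormSq A (u + v) ≤ (1 + t) * anormSq A u + (1 + 1 / t) * anormSq A v := by
  have h₁ := hA (t • u + v)
  have h₂ := hA ((-t) • u + v)
  have h := anormSq_smul_add A 1 u v
  rw [anormSq_smul_add] at h₁ h₂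
  rw [one_smul] at h
  set B := u ⬝ᵥ A.mulVec v + v ⬝ᵥ A.mulVec u
  have h₃ : 0 ≤ t * anormSq A u + B + 1 / t * anormSq A v := by
    refine (div_nonneg h₁ ht.le).trans_eq ?_
    field_simp
  have h₄ : 0 ≤ t * anormSq A u - B + 1 / t * anormSq A v := by
    refine (div_nonneg h₂ ht.le).trans_eq ?_
    field_simp
    ring
  constructor <;> linarith

theorem cost_nonneg {d k n : ℕ} {A : Fin k → Matrix (Fin d) (Fin d) ℝ}
    (hA : ∀ i w, 0 ≤ anormSq (A i) w) (x : Fin n → Fin d → ℝ) {ω : Fin n → ℝ}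
    (hω : ∀ j, 0 ≤ ω j) {ξ : Fin k → Fin n → ℝ} (hξ : IsClustering ξ) (s : Fin k → Fin d → ℝ) :
    0 ≤ cost A x ω ξ s :=
  sum_nonneg fun i _ => sum_nonneg fun j _ => mul_nonneg (mul_nonneg (hξ.1 i j) (hω j)) (hA _ _)

theorem OPTu_le_cost {d k n : ℕ} {A : Fin k → Matrix (Fin d) (Fin d) ℝ}
    (hA : ∀ i w, 0 ≤ anormSq (A i) w) (x : Fin n → Fin d → ℝ) {ω : Fin n → ℝ}
    (hω : ∀ j, 0 ≤ ω j) {ξ : Fin k → Fin n → ℝ} (hξ : IsClustering ξ) (s : Fin k → Fin d → ℝ) :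
    OPTu A x ω ≤ cost A x ω ξ s := by
  refine csInf_le ⟨0, ?_⟩ ⟨ξ, s, hξ, rfl⟩
  rintro _ ⟨ξ', s', hξ', rfl⟩
  exact cost_nonneg hA x hω hξ' s'

theorem assignCost_le_cost {d k n : ℕ} {κlo κhi : Fin k → ℝ}
    {A : Fin k → Matrix (Fin d) (Fin d) ℝ}
    (hA : ∀ i w, 0 ≤ anormSq (A i) w) (x : Fin n → Fin d → ℝ) {ω : Fin n → ℝ}
    (hω : ∀ j, 0 ≤ ω j) {ξ : Fin k → Fin n → ℝ} (hξ : IsWCC κlo κhi ω ξ)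
    (s : Fin k → Fin d → ℝ) :
    assignCost κlo κhi A x ω s ≤ cost A x ω ξ s := by
  refine csInf_le ⟨0, ?_⟩ ⟨ξ, hξ, rfl⟩
  rintro _ ⟨ξ', hξ', rfl⟩
  exact cost_nonneg hA x hω hξ'.1 s

/-- Moving the points `x j` to `y j` with small total squared displacement changes the cost of
every clustering by a factor of at most `1 ± ε`. -/
theorem cost_move_bounds {d k n : ℕ} {A : Fin k → Matrix (Fin d) (Fin d) ℝ}
    {x y : Fin n → Fin d → ℝ} {ω : Fin n → ℝ} (hω : ∀ j, 0 ≤ ω j) {lm lp ε : ℝ} (hlm : 0 < lm)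
    (hlow : ∀ i (u : Fin d → ℝ), lm * (u ⬝ᵥ u) ≤ anormSq (A i) u)
    (hup : ∀ i (u : Fin d → ℝ), anormSq (A i) u ≤ lp * (u ⬝ᵥ u))
    (hε : 0 < ε) (hε' : ε ≤ 1 / 2)
    (hmove : ∑ j, ω j * ((x j - y j) ⬝ᵥ (x j - y j))
      ≤ ε ^ 2 * lm / (16 * lp) * OPTu (fun _ : Fin k => (1 : Matrix (Fin d) (Fin d) ℝ)) x ω)
    {ξ : Fin k → Fin n → ℝ} (hξ : IsClustering ξ) (s : Fin k → Fin d → ℝ) :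
    (1 - ε) * cost A x ω ξ s ≤ cost A y ω ξ s ∧
      cost A y ω ξ s ≤ (1 + ε) * cost A x ω ξ s := by
  have hsq (u : Fin d → ℝ) : 0 ≤ u ⬝ᵥ u := sum_nonneg fun i _ => mul_self_nonneg (u i)
  have hA (i w) : 0 ≤ anormSq (A i) w := (mul_nonneg hlm.le (hsq w)).trans (hlow i w)
  have h1 (i : Fin k) (w : Fin d → ℝ) :
      0 ≤ anormSq ((fun _ : Fin k => (1 : Matrix (Fin d) (Fin d) ℝ)) i) w :=
    (anormSq_one w).symm ▸ hsq w
  have hw (i j) : 0 ≤ ξ i j * ω j := mul_nonneg (hξ.1 i j) (hω j)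
  have hOc := OPTu_le_cost h1 x hω hξ s
  set O := OPTu (fun _ : Fin k => (1 : Matrix (Fin d) (Fin d) ℝ)) x ω
  set M := ∑ j, ω j * ((x j - y j) ⬝ᵥ (x j - y j)) with hM
  have hM0 : 0 ≤ M := sum_nonneg fun j _ => mul_nonneg (hω j) (hsq _)
  set a := cost A x ω ξ s with ha
  set D := ∑ i, ∑ j, ξ i j * ω j * anormSq (A i) (y j - x j) with hD
  have ha0 : 0 ≤ a := cost_nonneg hA x hω hξ s
  have hlO : lm * O ≤ a := by
    refine (mul_le_mul_of_nonneg_left hOc hlm.le).trans ?_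
    simp only [ha, cost, mul_sum, anormSq_one]
    refine sum_le_sum fun i _ => sum_le_sum fun j _ => ?_
    rw [mul_left_comm]
    exact mul_le_mul_of_nonneg_left (hlow _ _) (hw i j)
  have hDM : D ≤ lp * M := by
    have : D ≤ ∑ i, ∑ j, ξ i j * ω j * (lp * ((x j - y j) ⬝ᵥ (x j - y j))) := by
      refine sum_le_sum fun i _ => sum_le_sum fun j _ => mul_le_mul_of_nonneg_left ?_ (hw i j)
      refine (hup i _).trans_eq ?_
      rw [← neg_sub (x j) (y j), neg_dotProduct_neg]
    refine this.trans_eq ?_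
    rw [sum_comm, hM, mul_sum]
    refine sum_congr rfl fun j _ => ?_
    rw [← sum_mul, ← sum_mul, hξ.2 j]
    ring
  have hDa : D ≤ (ε / 4) ^ 2 * a := by
    rcases le_or_gt lp 0 with hlp | hlp
    · exact (hDM.trans (mul_nonpos_of_nonpos_of_nonneg hlp hM0)).trans (by positivity)
    · calc D ≤ lp * M := hDM
        _ ≤ lp * (ε ^ 2 * lm / (16 * lp) * O) := mul_le_mul_of_nonneg_left hmove hlp.le
        _ = (ε / 4) ^ 2 * (lm * O) := by field_simp; ring
        _ ≤ (ε / 4) ^ 2 * a := by gcongr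
  have ht : 0 < ε / 4 := by positivity
  have key (i j) := anormSq_add_bounds (hA i) ht (x j - s i) (y j - x j)
  simp only [sub_add_sub_cancel'] at key
  have hlin (b c : ℝ) : ∑ i, ∑ j, ξ i j * ω j *
      (b * anormSq (A i) (x j - s i) + c * anormSq (A i) (y j - x j)) = b * a + c * D := by
    simp only [ha, hD, cost, mul_sum, ← sum_add_distrib]
    exact sum_congr rfl fun i _ => sum_congr rfl fun j _ => by ring
  have hlo : (1 - ε / 4) * a + (1 - 1 / (ε / 4)) * D ≤ cost A y ω ξ s := by
    rw [← hlin]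
    exact sum_le_sum fun i _ => sum_le_sum fun j _ =>
      mul_le_mul_of_nonneg_left (key i j).1 (hw i j)
  have hhi : cost A y ω ξ s ≤ (1 + ε / 4) * a + (1 + 1 / (ε / 4)) * D := by
    rw [← hlin]
    exact sum_le_sum fun i _ => sum_le_sum fun j _ =>
      mul_le_mul_of_nonneg_left (key i j).2 (hw i j)
  have h4 : 1 / (ε / 4) * D ≤ ε / 4 * a := by
    rw [div_mul_eq_mul_div, one_mul, div_le_iff₀ ht]
    linarith
  have hD0 : 0 ≤ D :=
    sum_nonneg fun i _ => sum_nonneg fun j _ => mul_nonneg (hw i j) (hA i _)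
  have hDb : D ≤ ε / 4 * a := by nlinarith
  constructor <;> nlinarith

theorem sum_fiber_mul {n m : ℕ} (p : Fin n → Fin m) (g : Fin n → ℝ) (h : Fin m → ℝ) :
    ∑ j', (∑ j ∈ univ.filter (fun j => p j = j'), g j) * h j' = ∑ j, g j * h (p j) := by
  rw [← sum_fiberwise univ p]
  refine sum_congr rfl fun j' _ => ?_
  rw [sum_mul]
  exact sum_congr rfl fun j hj => by rw [(mem_filter.1 hj).2]

theorem statement10 {d k n m : ℕ}
    (κlo κhi : Fin k → ℝ) (hκ : ∀ i, κlo i ≤ κhi i)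
    (A : Fin k → Matrix (Fin d) (Fin d) ℝ) (hA : ∀ i, (A i).PosDef)
    (x : Fin n → Fin d → ℝ) (ω : Fin n → ℝ) (hω : ∀ j, 0 < ω j)
    (hne : ∃ ξ, IsWCC κlo κhi ω ξ)
    (p : Fin n → Fin m) (hp : Function.Surjective p)
    (x' : Fin m → Fin d → ℝ)
    (ω' : Fin m → ℝ) (hω' : ω' = fun j' => ∑ j ∈ univ.filter (fun j => p j = j'), ω j)
    (lm lp : ℝ) (hlm : 0 < lm)
    (hlow : ∀ i (u : Fin d → ℝ), lm * (u ⬝ᵥ u) ≤ anormSq (A i) u)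
    (hup : ∀ i (u : Fin d → ℝ), anormSq (A i) u ≤ lp * (u ⬝ᵥ u))
    (ε : ℝ) (hε : 0 < ε ∧ ε ≤ 1 / 2)
    (hmove : ∑ j, ω j * ((x j - x' (p j)) ⬝ᵥ (x j - x' (p j)))
      ≤ ε ^ 2 * lm / (16 * lp) * OPTu (fun _ : Fin k => (1 : Matrix (Fin d) (Fin d) ℝ)) x ω) :
    IsCoresetWith ε 1 κlo κhi A x ω x' ω' (fun ξ' i j => ξ' i (p j)) 0 0 := by
  have hω₀ (j) : 0 ≤ ω j := (hω j).le
  have hA₀ (i w) : 0 ≤ anormSq (A i) w :=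
    (mul_nonneg hlm.le (sum_nonneg fun l _ => mul_self_nonneg (w l))).trans (hlow i w)
  have hω'pos (j') : 0 < ω' j' := by
    obtain ⟨j, hj⟩ := hp j'
    rw [hω']
    exact sum_pos (fun j _ => hω j) ⟨j, by simp [hj]⟩
  have hmain {ξ : Fin k → Fin n → ℝ} (hξ : IsClustering ξ) (s : Fin k → Fin d → ℝ) :=
    cost_move_bounds (y := fun j => x' (p j)) hω₀ hlm hlow hup hε.1 hε.2 hmove hξ s
  have hext (ξ') (hξ' : IsWCC κlo κhi ω' ξ') : IsWCC κlo κhi ω (fun i j => ξ' i (p j)) := by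
    refine ⟨⟨fun i j => hξ'.1.1 i (p j), fun j => hξ'.1.2 (p j)⟩, fun i => ?_⟩
    have : clusterWeight ω (fun i j => ξ' i (p j)) i = clusterWeight ω' ξ' i := by
      have := sum_fiber_mul p ω (ξ' i)
      simpa only [clusterWeight, hω', mul_comm] using this.symm
    exact this ▸ hξ'.2 i
  refine ⟨le_rfl, by simp, hext, fun s ξ' hξ' => ⟨?_, ?_⟩⟩
  · have : cost A x' ω' ξ' s = cost A (fun j => x' (p j)) ω (fun i j => ξ' i (p j)) s := by
      refine sum_congr rfl fun i _ => ?_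
      have := sum_fiber_mul p ω fun j' => ξ' i j' * anormSq (A i) (x' j' - s i)
      simpa only [hω', mul_comm, mul_left_comm, mul_assoc] using this
    rw [add_zero, this]
    exact (hmain (hext ξ' hξ').1 s).1
  · rw [add_zero]
    have hε₁ : 0 < 1 + ε := by linarith [hε.1]
    rw [← div_le_iff₀' hε₁]
    obtain ⟨ξ₀, hξ₀⟩ := hne
    refine le_csInf ⟨_, ξ₀, hξ₀, rfl⟩ ?_
    rintro _ ⟨ξ, hξ, rfl⟩
    rw [div_le_iff₀' hε₁]
    refine le_trans ?_ (hmain hξ.1 s).2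
    set η : Fin k → Fin m → ℝ := fun i j' =>
      (∑ j ∈ univ.filter (fun j => p j = j'), ξ i j * ω j) / ω' j' with hη
    have hηω (i j') : η i j' * ω' j' = ∑ j ∈ univ.filter (fun j => p j = j'), ξ i j * ω j :=
      div_mul_cancel₀ _ (hω'pos j').ne'
    have hηc : IsWCC κlo κhi ω' η := by
      refine ⟨⟨fun i j' => div_nonneg (sum_nonneg fun j _ => mul_nonneg (hξ.1.1 i j) (hω₀ j))
        (hω'pos j').le, fun j' => ?_⟩, fun i => ?_⟩
      · rw [hη, ← sum_div, div_eq_one_iff_eq (hω'pos j').ne', sum_comm, hω']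
        exact sum_congr rfl fun j _ => by rw [← sum_mul, hξ.1.2 j, one_mul]
      · have : clusterWeight ω' η i = clusterWeight ω ξ i := by
          simp only [clusterWeight, hηω]
          exact sum_fiberwise univ p _
        exact this ▸ hξ.2 i
    have : cost A x' ω' η s = cost A (fun j => x' (p j)) ω ξ s := by
      refine sum_congr rfl fun i _ => ?_
      simp only [hηω]
      exact sum_fiber_mul p (fun j => ξ i j * ω j) fun j' => anormSq (A i) (x' j' - s i)
    exact this ▸ assignCost_le_cost hA₀ x' (fun j' => (hω'pos j').le) hηc s

end
end
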